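/- arXiv:1403.2253 — 7 statements merged into one kernel-verified Lean document; each statement's English description precedes it below -/
import Mathlib

section
/- Suppose there exists a bounded linear operator A : 𝔅 → 𝔅 such that the operator T − I⁻∘A∘I⁺ : 𝔇⁺ → 𝔇⁻ is boundedly invertible. Then the operator T• in 𝔅 is closed and densely defined. -/
noncomputable section

/-- Bounded invertibility of a continuous linear map: existence of a two-sided
continuous linear inverse. -/
def BInv {X Y : Type*} [NormedAddCommGroup X] [NormedSpace ℂ X]
    [NormedAddCommGroup Y] [NormedSpace ℂ Y] (f : X →L[ℂ] Y) : Prop :=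
  ∃ g : Y →L[ℂ] X, g.comp f = ContinuousLinearMap.id ℂ X ∧
    f.comp g = ContinuousLinearMap.id ℂ Y

/-- Let `𝔅, 𝔇⁺, 𝔇⁻` be complex Banach spaces, `I⁺ : 𝔇⁺ → 𝔅` and
`I⁻ : 𝔅 → 𝔇⁻` injective bounded linear maps with dense ranges, and
`T : 𝔇⁺ → 𝔇⁻` a bounded linear operator.  Suppose there exists a bounded linear
operator `A : 𝔅 → 𝔅` such that `T - I⁻ ∘ A ∘ I⁺` is boundedly invertible.  Then
the operator `T• = (I⁻)⁻¹ ∘ T ∘ (I⁺)⁻¹` in `𝔅` (described here through its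
graph `{(x, z) | ∃ y, x = I⁺ y ∧ T y = I⁻ z}`) is closed and densely defined. -/
theorem statement0
    {B Dp Dm : Type*}
    [NormedAddCommGroup B] [NormedSpace ℂ B] [CompleteSpace B]
    [NormedAddCommGroup Dp] [NormedSpace ℂ Dp] [CompleteSpace Dp]
    [NormedAddCommGroup Dm] [NormedSpace ℂ Dm] [CompleteSpace Dm]
    (Ip : Dp →L[ℂ] B) (Im : B →L[ℂ] Dm)
    (hIpinj : Function.Injective Ip) (hIminj : Function.Injective Im)
    (hIpdense : DenseRange Ip) (hImdense : DenseRange Im)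
    (T : Dp →L[ℂ] Dm)
    (A : B →L[ℂ] B)
    (hA : BInv (T - Im.comp (A.comp Ip))) :
    IsClosed {p : B × B | ∃ y : Dp, p.1 = Ip y ∧ T y = Im p.2} ∧
    Dense {x : B | ∃ y : Dp, x = Ip y ∧ T y ∈ Set.range Im} := by
  obtain ⟨g, hgS, hSg⟩ := hA
  have left_inv (y : Dp) : g (T y - Im (A (Ip y))) = y := by
    simpa using DFunLike.congr_fun hgS y
  have right_inv (w : Dm) : T (g w) - Im (A (Ip (g w))) = w := by
    simpa using DFunLike.congr_fun hSg w
  constructor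
  · have graph_eq : {p : B × B | ∃ y : Dp, p.1 = Ip y ∧ T y = Im p.2} =
        {p : B × B | p.1 = Ip (g (Im (p.2 - A p.1)))} := by
      ext ⟨x, z⟩
      constructor
      · rintro ⟨y, hx, hy⟩
        dsimp only at hx hy
        change x = Ip (g (Im (z - A x)))
        rw [map_sub, ← hy, hx, left_inv]
      · intro hx
        change x = Ip (g (Im (z - A x))) at hx
        refine ⟨g (Im (z - A x)), hx, ?_⟩
        have h := right_inv (Im (z - A x))
        rw [← hx, map_sub] at h
        simpa using h
    rw [graph_eq]
    exact isClosed_eq (by fun_prop) (by fun_prop)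
  · have g_surjective : Function.Surjective g := fun y => ⟨_, left_inv y⟩
    have dense_range : DenseRange (Ip ∘ (g ∘ Im)) :=
      hIpdense.comp (g_surjective.denseRange.comp hImdense g.continuous) Ip.continuous
    refine Dense.mono ?_ dense_range
    rintro _ ⟨z, rfl⟩
    refine ⟨g (Im z), rfl, z + A (Ip (g (Im z))), ?_⟩
    rw [map_add, ← sub_eq_iff_eq_add.mp (right_inv (Im z))]
end
end

section
/- Every λ ∈ ℂ for which the operator T♮(λ) = T − λ·I⁻∘I⁺ : 𝔇⁺ → 𝔇⁻ is boundedly invertible belongs to the resolvent set of T•, and for such λ the resolvent satisfies (T• − λ)⁻¹ = I⁺ ∘ (T − λ·I⁻∘I⁺)⁻¹ ∘ I⁻ as bounded operators on 𝔅. -/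
noncomputable section

/-- Every `λ ∈ ℂ` for which `T♮(λ) = T - λ·I⁻∘I⁺ : 𝔇⁺ → 𝔇⁻` is
boundedly invertible (with inverse `S`) belongs to the resolvent set of `T•`,
and the resolvent is `(T• - λ)⁻¹ = I⁺ ∘ S ∘ I⁻ : 𝔅 → 𝔅`; that is, the bounded
operator `R = I⁺ ∘ S ∘ I⁻` maps `𝔅` into the domain of `T•` with
`(T• - λ) (R x) = x` for every `x`, and `R ((T• - λ) x) = x` for every `x` in
the domain of `T•`.  (The graph of `T•` is `{(x, z) | ∃ y, x = I⁺ y ∧ T y = I⁻ z}`.) -/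
theorem statement1
    {B Dp Dm : Type*}
    [NormedAddCommGroup B] [NormedSpace ℂ B] [CompleteSpace B]
    [NormedAddCommGroup Dp] [NormedSpace ℂ Dp] [CompleteSpace Dp]
    [NormedAddCommGroup Dm] [NormedSpace ℂ Dm] [CompleteSpace Dm]
    (Ip : Dp →L[ℂ] B) (Im : B →L[ℂ] Dm)
    (hIpinj : Function.Injective Ip) (hIminj : Function.Injective Im)
    (hIpdense : DenseRange Ip) (hImdense : DenseRange Im)
    (T : Dp →L[ℂ] Dm)
    (lam : ℂ) (S : Dm →L[ℂ] Dp)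
    (hS1 : S.comp (T - lam • Im.comp Ip) = ContinuousLinearMap.id ℂ Dp)
    (hS2 : (T - lam • Im.comp Ip).comp S = ContinuousLinearMap.id ℂ Dm) :
    (∀ x : B, ∃ y : Dp, (Ip.comp (S.comp Im)) x = Ip y ∧
        T y = Im (x + lam • (Ip.comp (S.comp Im)) x)) ∧
    (∀ x z : B, (∃ y : Dp, x = Ip y ∧ T y = Im z) →
        (Ip.comp (S.comp Im)) (z - lam • x) = x) := by
  refine ⟨fun x => ⟨S (Im x), rfl, ?_⟩, ?_⟩
  · have h : T (S (Im x)) - lam • Im (Ip (S (Im x))) = Im x :=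
      DFunLike.congr_fun hS2 (Im x)
    simpa only [ContinuousLinearMap.comp_apply, map_add, map_smul] using sub_eq_iff_eq_add.mp h
  · rintro _ z ⟨y, rfl, hy⟩
    have h : S (T y - lam • Im (Ip y)) = y := DFunLike.congr_fun hS1 y
    rw [hy] at h
    simp only [ContinuousLinearMap.comp_apply, map_sub Im, map_smul Im, h]
end
end

section
/- Suppose there exists a bounded linear operator A : 𝔅 → 𝔅 such that the operator T − I⁻∘A∘I⁺ : 𝔇⁺ → 𝔇⁻ is boundedly invertible. Then for every λ in the resolvent set of T•, the operator T♮(λ) = T − λ·I⁻∘I⁺ : 𝔇⁺ → 𝔇⁻ is also boundedly invertible. -/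
noncomputable section

/-- Suppose there exists a bounded linear operator `A : 𝔅 → 𝔅`
such that `T - I⁻∘A∘I⁺ : 𝔇⁺ → 𝔇⁻` is boundedly invertible.  Then for every `λ`
in the resolvent set of `T•` (i.e. such that `T• - λ` possesses a bounded
everywhere defined two-sided inverse `R`), the operator
`T♮(λ) = T - λ·I⁻∘I⁺ : 𝔇⁺ → 𝔇⁻` is also boundedly invertible.
(The graph of `T•` is `{(x, z) | ∃ y, x = I⁺ y ∧ T y = I⁻ z}`.) -/
theorem statement2
    {B Dp Dm : Type*}
    [NormedAddCommGroup B] [NormedSpace ℂ B] [CompleteSpace B]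
    [NormedAddCommGroup Dp] [NormedSpace ℂ Dp] [CompleteSpace Dp]
    [NormedAddCommGroup Dm] [NormedSpace ℂ Dm] [CompleteSpace Dm]
    (Ip : Dp →L[ℂ] B) (Im : B →L[ℂ] Dm)
    (hIpinj : Function.Injective Ip) (hIminj : Function.Injective Im)
    (hIpdense : DenseRange Ip) (hImdense : DenseRange Im)
    (T : Dp →L[ℂ] Dm)
    (A : B →L[ℂ] B)
    (hA : BInv (T - Im.comp (A.comp Ip)))
    (lam : ℂ)
    (hlam : ∃ R : B →L[ℂ] B,
      (∀ x : B, ∃ y : Dp, R x = Ip y ∧ T y = Im (x + lam • R x)) ∧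
      (∀ x z : B, (∃ y : Dp, x = Ip y ∧ T y = Im z) → R (z - lam • x) = x)) :
    BInv (T - lam • Im.comp Ip) := by
  obtain ⟨G, hGS, hSG⟩ := hA
  obtain ⟨R, hR, hR'⟩ := hlam
  have hG (y : Dp) : G (T y - Im (A (Ip y))) = y := by
    simpa using DFunLike.congr_fun hGS y
  have hS (f : Dm) : T (G f) - Im (A (Ip (G f))) = f := by
    simpa using DFunLike.congr_fun hSG f
  have hinj : ∀ y : Dp, (T - lam • Im.comp Ip) y = 0 → y = 0 := by
    intro y hy
    have hy' : T y = Im (lam • Ip y) := by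
      simpa [sub_eq_zero] using hy
    have h := hR' (Ip y) (lam • Ip y) ⟨y, rfl, hy'⟩
    rw [sub_self, map_zero] at h
    exact hIpinj (by rw [← h, map_zero])
  let C : B →L[ℂ] B := A - lam • ContinuousLinearMap.id ℂ B
  -- A bounded right inverse of `T - lam • Im.comp Ip` on the range of `Im`.
  let W : B →L[ℂ] Dp := G.comp (Im.comp (ContinuousLinearMap.id ℂ B - C.comp R))
  have hW (x : B) : T (W x) - lam • Im (Ip (W x)) = Im x := by
    obtain ⟨y, hy, hTy⟩ := hR x
    have hWy : W x = y := by
      rw [← hG y, hTy, ← hy]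
      simp only [W, C, ContinuousLinearMap.comp_apply, sub_apply,
        smul_apply, ContinuousLinearMap.id_apply, ← map_sub]
      congr 2
      abel
    rw [hWy, hTy, ← hy, map_add, map_smul, add_sub_cancel_right]
  let K : Dm →L[ℂ] Dp := G - W.comp (C.comp (Ip.comp G))
  have hK (f : Dm) : (T - lam • Im.comp Ip) (K f) = f := by
    have h₁ := hW (C (Ip (G f)))
    have h₂ : Im (C (Ip (G f))) = Im (A (Ip (G f))) - lam • Im (Ip (G f)) := by
      simp [C]
    have h₃ : (T - lam • Im.comp Ip) (K f) =
        (T (G f) - lam • Im (Ip (G f))) -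
          (T (W (C (Ip (G f)))) - lam • Im (Ip (W (C (Ip (G f)))))) := by
      simp only [K, ContinuousLinearMap.comp_apply, sub_apply,
        smul_apply, map_sub]
    rw [h₃, h₁, h₂, sub_sub_sub_cancel_right]
    exact hS f
  refine ⟨K, ?_, ContinuousLinearMap.ext hK⟩
  ext y
  exact sub_eq_zero.mp (hinj _ (by
    rw [map_sub, ContinuousLinearMap.comp_apply, hK, ContinuousLinearMap.id_apply, sub_self]))
end
end

section
/- Suppose there exists a bounded linear operator A : 𝔅 → 𝔅 such that the operator T − I⁻∘A∘I⁺ : 𝔇⁺ → 𝔇⁻ is boundedly invertible. Then the spectrum of the operator T• coincides exactly with the spectrum of the linear pencil T♮, i.e. for every λ ∈ ℂ one has λ ∈ σ(T•) if and only if the operator T♮(λ) = T − λ·I⁻∘I⁺ is not boundedly invertible. -/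
noncomputable section

/-- Suppose there exists a bounded linear operator `A : 𝔅 → 𝔅`
such that `T - I⁻∘A∘I⁺ : 𝔇⁺ → 𝔇⁻` is boundedly invertible.  Then the spectrum of
`T•` coincides exactly with the spectrum of the linear pencil `T♮`: for every
`λ ∈ ℂ`, `λ ∈ σ(T•)` (i.e. `T• - λ` possesses no bounded everywhere defined
two-sided inverse) if and only if `T♮(λ) = T - λ·I⁻∘I⁺` is not boundedly
invertible.  (The graph of `T•` is `{(x, z) | ∃ y, x = I⁺ y ∧ T y = I⁻ z}`.) -/
theorem statement3
    {B Dp Dm : Type*}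
    [NormedAddCommGroup B] [NormedSpace ℂ B] [CompleteSpace B]
    [NormedAddCommGroup Dp] [NormedSpace ℂ Dp] [CompleteSpace Dp]
    [NormedAddCommGroup Dm] [NormedSpace ℂ Dm] [CompleteSpace Dm]
    (Ip : Dp →L[ℂ] B) (Im : B →L[ℂ] Dm)
    (hIpinj : Function.Injective Ip) (hIminj : Function.Injective Im)
    (hIpdense : DenseRange Ip) (hImdense : DenseRange Im)
    (T : Dp →L[ℂ] Dm)
    (A : B →L[ℂ] B)
    (hA : BInv (T - Im.comp (A.comp Ip))) :
    ∀ lam : ℂ,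
      (¬ ∃ R : B →L[ℂ] B,
        (∀ x : B, ∃ y : Dp, R x = Ip y ∧ T y = Im (x + lam • R x)) ∧
        (∀ x z : B, (∃ y : Dp, x = Ip y ∧ T y = Im z) → R (z - lam • x) = x)) ↔
      ¬ BInv (T - lam • Im.comp Ip) := by
  intro lam
  rw [not_iff_not]
  constructor
  · rintro ⟨R, hR, hL⟩
    obtain ⟨G, hGS, hSG⟩ := hA
    have hGS' : ∀ y, G (T y - Im (A (Ip y))) = y := fun y => by
      simpa using DFunLike.congr_fun hGS y
    have hSG' : ∀ w, T (G w) - Im (A (Ip (G w))) = w := fun w => by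
      simpa using DFunLike.congr_fun hSG w
    have hinj : ∀ y, (T - lam • Im.comp Ip) y = 0 → y = 0 := fun y hy => by
      have hTy : T y = Im (lam • Ip y) := by
        simpa [sub_eq_zero] using hy
      have h := hL (Ip y) (lam • Ip y) ⟨y, rfl, hTy⟩
      rw [sub_self, map_zero] at h
      exact hIpinj (by rw [← h, map_zero])
    let C : B →L[ℂ] B := A - lam • ContinuousLinearMap.id ℂ B
    let H : Dm →L[ℂ] Dp :=
      G - G.comp (Im.comp ((ContinuousLinearMap.id ℂ B - C.comp R).comp (C.comp (Ip.comp G))))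
    have hH : ∀ w, (T - lam • Im.comp Ip) (H w) = w := fun w => by
      obtain ⟨y, hRy, hTy⟩ := hR (C (Ip (G w)))
      have hy : H w = G w - y := by
        have h := hGS' y
        rw [hTy, ← hRy, ← map_sub] at h
        simp only [H, sub_apply, ContinuousLinearMap.comp_apply,
          ContinuousLinearMap.id_apply]
        rw [← h]
        congr 3
        simp only [C, sub_apply, smul_apply,
          ContinuousLinearMap.id_apply]
        abel
      have hw := hSG' w
      rw [hRy] at hTy
      rw [hy]
      simp only [sub_apply, smul_apply,
        ContinuousLinearMap.comp_apply, map_sub, hTy, map_add, map_smul, C,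
        ContinuousLinearMap.id_apply]
      refine Eq.trans ?_ hw
      abel
    refine ⟨H, ?_, ContinuousLinearMap.ext hH⟩
    ext y
    have h := hinj (H ((T - lam • Im.comp Ip) y) - y) (by rw [map_sub, hH, sub_self])
    exact sub_eq_zero.mp h
  · rintro ⟨H, hHT, hTH⟩
    refine ⟨Ip.comp (H.comp Im), fun x => ⟨H (Im x), rfl, ?_⟩, ?_⟩
    · have h : T (H (Im x)) - lam • Im (Ip (H (Im x))) = Im x := by
        simpa using DFunLike.congr_fun hTH (Im x)
      simpa using sub_eq_iff_eq_add.mp h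
    · rintro _ z ⟨y, rfl, hTy⟩
      have h : H ((T - lam • Im.comp Ip) y) = y := DFunLike.congr_fun hHT y
      have hz : Im (z - lam • Ip y) = (T - lam • Im.comp Ip) y := by
        simp [hTy]
      simp only [ContinuousLinearMap.comp_apply]
      rw [hz, h]
end
end

section
/- Suppose there are real numbers κ, τ and ε > 0 such that ((T₂₂ − τ·I₂*I₂) y)(y) ≤ −ε·‖y‖²_{D₂} for all y ∈ D₂ (so that D_τ := T₂₂ − τ·I₂*I₂ is boundedly invertible), and such that the Schur complement S_{κ,τ} := T₁₁ − κ·I₁*I₁ − T₁₂ D_τ⁻¹ T₂₁ : D₁ → D₁* satisfies (S_{κ,τ} y)(y) ≥ ε·‖y‖²_{D₁} for all y ∈ D₁. Then the block operator T − (κ·I₁*I₁ ⊕ τ·I₂*I₂) : D → D* is boundedly invertible. -/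
open scoped InnerProductSpace ComplexConjugate

noncomputable section

/-- A coercive bounded operator from a Hilbert space to its anti-dual is bijective. -/
theorem bijective_of_coercive_antidual {E : Type*} [NormedAddCommGroup E] [InnerProductSpace ℂ E]
    [CompleteSpace E] (S : E →L[ℂ] (E →L⋆[ℂ] ℂ)) {ε : ℝ} (hε : 0 < ε)
    (hS : ∀ y, ε * ‖y‖ ^ 2 ≤ (S y y).re) : Function.Bijective S := by
  let J : E →L[ℂ] (E →L⋆[ℂ] ℂ) := innerSLFlip ℂ
  have hJ (x y : E) : J x y = ⟪y, x⟫_ℂ := rfl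
  have hJinj : Function.Injective J := fun x y h =>
    ext_inner_left ℂ fun v => by rw [← hJ, ← hJ, h]
  have hJsurj : Function.Surjective J := by
    intro φ
    let ψ : StrongDual ℂ E := (starL ℂ : ℂ ≃L⋆[ℂ] ℂ).toContinuousLinearMap.comp φ
    refine ⟨(InnerProductSpace.toDual ℂ E).symm ψ, ?_⟩
    ext v
    rw [hJ, ← inner_conj_symm, InnerProductSpace.toDual_symm_apply]
    exact star_star (φ v)
  let e := ContinuousLinearEquiv.ofBijective J (LinearMap.ker_eq_bot.2 hJinj)
    (LinearMap.range_eq_top.2 hJsurj)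
  let f : E →L[ℂ] E := e.symm.toContinuousLinearMap.comp S
  have hf (x y : E) : ⟪y, f x⟫_ℂ = S x y := by
    rw [← hJ]
    exact congrArg (fun φ : E →L⋆[ℂ] ℂ => φ y) (e.apply_symm_apply (S x))
  have hunit : IsUnit f := by
    refine ContinuousLinearMap.isUnit_of_forall_le_norm_inner_map f
      (c := ⟨ε, hε.le⟩) hε fun x => ?_
    rw [norm_inner_symm, hf]
    calc ‖x‖ ^ 2 * ε = ε * ‖x‖ ^ 2 := mul_comm _ _
      _ ≤ (S x x).re := hS x
      _ ≤ ‖S x x‖ := Complex.re_le_norm _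
  have hfbij : Function.Bijective f := ContinuousLinearMap.isUnit_iff_bijective.1 hunit
  have hSe : (S : E → (E →L⋆[ℂ] ℂ)) = e ∘ f := by
    funext x
    exact (e.apply_symm_apply (S x)).symm
  rw [hSe]
  exact e.bijective.comp hfbij

/-- A block operator into an anti-dual is bijective if its lower right corner is invertible
and the corresponding Schur complement is bijective. -/
theorem bijective_block_of_schur {X Y : Type*}
    [NormedAddCommGroup X] [NormedSpace ℂ X] [NormedAddCommGroup Y] [NormedSpace ℂ Y]
    (A : X →L[ℂ] (X →L⋆[ℂ] ℂ)) (B : Y →L[ℂ] (X →L⋆[ℂ] ℂ))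
    (C : X →L[ℂ] (Y →L⋆[ℂ] ℂ)) (D : Y →L[ℂ] (Y →L⋆[ℂ] ℂ))
    (G : (Y →L⋆[ℂ] ℂ) →L[ℂ] Y)
    (hGD : G.comp D = ContinuousLinearMap.id ℂ Y)
    (hDG : D.comp G = ContinuousLinearMap.id ℂ (Y →L⋆[ℂ] ℂ))
    (hS : Function.Bijective (A - B.comp (G.comp C)))
    (M : (X × Y) →L[ℂ] ((X × Y) →L⋆[ℂ] ℂ))
    (hM : ∀ u v : X × Y, M u v = A u.1 v.1 + B u.2 v.1 + C u.1 v.2 + D u.2 v.2) :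
    Function.Bijective M := by
  have hGD' (y : Y) : G (D y) = y := congrArg (fun f : Y →L[ℂ] Y => f y) hGD
  have hDG' (φ : Y →L⋆[ℂ] ℂ) : D (G φ) = φ := DFunLike.congr_fun hDG φ
  constructor
  · refine (injective_iff_map_eq_zero M).2 fun u hu => ?_
    have h1 : A u.1 + B u.2 = 0 := by
      ext v
      simpa [hu] using (hM u (v, 0)).symm
    have h2 : D u.2 = -C u.1 := by
      refine eq_neg_of_add_eq_zero_right ?_
      ext v
      simpa [hu] using (hM u (0, v)).symm
    have h3 : u.2 = -G (C u.1) := by rw [← hGD' u.2, h2, map_neg]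
    have h4 : u.1 = 0 := by
      refine (injective_iff_map_eq_zero _).1 hS.1 u.1 ?_
      rw [h3, map_neg, ← sub_eq_add_neg] at h1
      exact h1
    exact Prod.ext h4 (by simp [h3, h4])
  · intro φ
    let φ₁ : X →L⋆[ℂ] ℂ := φ.comp (ContinuousLinearMap.inl ℂ X Y)
    let φ₂ : Y →L⋆[ℂ] ℂ := φ.comp (ContinuousLinearMap.inr ℂ X Y)
    obtain ⟨x, hx⟩ := hS.2 (φ₁ - B (G φ₂))
    have hx' : A x - B (G (C x)) = φ₁ - B (G φ₂) := hx
    refine ⟨(x, G (φ₂ - C x)), ?_⟩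
    have h1 : A x + B (G (φ₂ - C x)) = φ₁ := by
      rw [map_sub, map_sub, ← sub_add_cancel (A x) (B (G (C x))), hx']
      abel
    have h2 : C x + D (G (φ₂ - C x)) = φ₂ := by
      rw [hDG']
      abel
    ext v
    have hφ : φ v = φ₁ v.1 + φ₂ v.2 := by
      change φ v = φ (v.1, 0) + φ (0, v.2)
      rw [← map_add]
      simp
    rw [hM, hφ, add_assoc]
    exact congrArg₂ (· + ·) (DFunLike.congr_fun h1 v.1) (DFunLike.congr_fun h2 v.2)

/-- A bijective bounded operator between Banach spaces is boundedly invertible. -/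
theorem BInv.of_bijective {X Y : Type*} [NormedAddCommGroup X] [NormedSpace ℂ X] [CompleteSpace X]
    [NormedAddCommGroup Y] [NormedSpace ℂ Y] [CompleteSpace Y] {f : X →L[ℂ] Y}
    (hf : Function.Bijective f) : BInv f := by
  let e := ContinuousLinearEquiv.ofBijective f (LinearMap.ker_eq_bot.2 hf.1)
    (LinearMap.range_eq_top.2 hf.2)
  exact ⟨e.symm, ContinuousLinearMap.ext e.symm_apply_apply,
    ContinuousLinearMap.ext e.apply_symm_apply⟩

/-- Let `T : D → D*` (`D = D₁ ⊕ D₂`) be the symmetric block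
operator built from bounded operators `T₁₁, T₁₂, T₂₁, T₂₂`, with embeddings
`I₁ : D₁ → H₁`, `I₂ : D₂ → H₂` (injective, dense ranges) and adjoint embeddings
`I₁*, I₂*`.  Suppose there are real `κ, τ` and `ε > 0` such that
`((T₂₂ - τ·I₂*I₂) y)(y) ≤ -ε·‖y‖²` for all `y ∈ D₂` (so that
`D_τ = T₂₂ - τ·I₂*I₂` is boundedly invertible, with inverse `G`), and such that
the Schur complement `S_{κ,τ} = T₁₁ - κ·I₁*I₁ - T₁₂ G T₂₁` satisfies
`(S_{κ,τ} y)(y) ≥ ε·‖y‖²` for all `y ∈ D₁`.  Then the block operator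
`T - (κ·I₁*I₁ ⊕ τ·I₂*I₂) : D → D*` is boundedly invertible. -/
theorem statement5
    {H1 H2 D1 D2 : Type*}
    [NormedAddCommGroup H1] [InnerProductSpace ℂ H1] [CompleteSpace H1]
    [NormedAddCommGroup H2] [InnerProductSpace ℂ H2] [CompleteSpace H2]
    [NormedAddCommGroup D1] [InnerProductSpace ℂ D1] [CompleteSpace D1]
    [NormedAddCommGroup D2] [InnerProductSpace ℂ D2] [CompleteSpace D2]
    (I1 : D1 →L[ℂ] H1) (I2 : D2 →L[ℂ] H2)
    (hI1inj : Function.Injective I1) (hI2inj : Function.Injective I2)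
    (hI1dense : DenseRange I1) (hI2dense : DenseRange I2)
    (T11 : D1 →L[ℂ] (D1 →L⋆[ℂ] ℂ)) (T12 : D2 →L[ℂ] (D1 →L⋆[ℂ] ℂ))
    (T21 : D1 →L[ℂ] (D2 →L⋆[ℂ] ℂ)) (T22 : D2 →L[ℂ] (D2 →L⋆[ℂ] ℂ))
    -- symmetry of the block operator
    (hsymm : ∀ u v : D1 × D2,
      T11 u.1 v.1 + T12 u.2 v.1 + T21 u.1 v.2 + T22 u.2 v.2 =
        conj (T11 v.1 u.1 + T12 v.2 u.1 + T21 v.1 u.2 + T22 v.2 u.2))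
    -- the adjoint embeddings I₁*, I₂*
    (I1s : H1 →L[ℂ] (D1 →L⋆[ℂ] ℂ)) (I2s : H2 →L[ℂ] (D2 →L⋆[ℂ] ℂ))
    (hI1s : ∀ (x : H1) (y : D1), I1s x y = @inner ℂ _ _ (I1 y) x)
    (hI2s : ∀ (x : H2) (y : D2), I2s x y = @inner ℂ _ _ (I2 y) x)
    -- the block operator T : D → D* and the operators I₁*I₁ ⊕ 0, 0 ⊕ I₂*I₂
    (Tfull Q1 Q2 : (D1 × D2) →L[ℂ] ((D1 × D2) →L⋆[ℂ] ℂ))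
    (hTfull : ∀ u v : D1 × D2,
      Tfull u v = T11 u.1 v.1 + T12 u.2 v.1 + T21 u.1 v.2 + T22 u.2 v.2)
    (hQ1 : ∀ u v : D1 × D2, Q1 u v = @inner ℂ _ _ (I1 v.1) (I1 u.1))
    (hQ2 : ∀ u v : D1 × D2, Q2 u v = @inner ℂ _ _ (I2 v.2) (I2 u.2))
    -- the data
    (κ τ ε : ℝ) (hε : 0 < ε)
    -- uniform negativity of D_τ = T₂₂ - τ·I₂*I₂
    (hneg : ∀ y : D2,
      (((T22 - (τ : ℂ) • I2s.comp I2) y) y).re ≤ -ε * ‖y‖ ^ 2)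
    -- G = D_τ⁻¹
    (G : (D2 →L⋆[ℂ] ℂ) →L[ℂ] D2)
    (hG1 : G.comp (T22 - (τ : ℂ) • I2s.comp I2) = ContinuousLinearMap.id ℂ D2)
    (hG2 : (T22 - (τ : ℂ) • I2s.comp I2).comp G =
      ContinuousLinearMap.id ℂ (D2 →L⋆[ℂ] ℂ))
    -- uniform positivity of the Schur complement S_{κ,τ}
    (hpos : ∀ y : D1,
      ε * ‖y‖ ^ 2 ≤
        (((T11 - (κ : ℂ) • I1s.comp I1 - T12.comp (G.comp T21)) y) y).re) :
    BInv (Y := (D1 × D2) →L⋆[ℂ] ℂ) (Tfull - (κ : ℂ) • Q1 - (τ : ℂ) • Q2) := by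
  have hS := bijective_of_coercive_antidual
    (T11 - (κ : ℂ) • I1s.comp I1 - T12.comp (G.comp T21)) hε hpos
  refine BInv.of_bijective (bijective_block_of_schur _ T12 T21 _ G hG1 hG2 hS _ fun u v => ?_)
  simp only [sub_apply, smul_apply, ContinuousLinearMap.comp_apply, hTfull, hQ1, hQ2, hI1s, hI2s]
  ring
end
end

section
/- Let J ⊆ ℝ be an interval such that for every λ ∈ J the operator T₂₂ − λ·I₂*I₂ : D₂ → D₂* is boundedly invertible, and let S(λ) = T₁₁ − λ·I₁*I₁ − T₁₂ (T₂₂ − λ·I₂*I₂)⁻¹ T₂₁. Then for every fixed y ∈ D₁ the real-valued function λ ↦ (S(λ) y)(y) is differentiable on J with derivative d/dλ (S(λ)y)(y) = −‖I₁ y‖²_{H₁} − ‖I₂ (T₂₂ − λ·I₂*I₂)⁻¹ T₂₁ y‖²_{H₂}; consequently, for any λ₁ < λ₂ in J one has (S(λ₂)y)(y) − (S(λ₁)y)(y) ≤ −(λ₂ − λ₁)·‖I₁ y‖²_{H₁}. -/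
open scoped InnerProductSpace ComplexConjugate

noncomputable section

section Resolvent

variable {H D : Type*} [NormedAddCommGroup H] [InnerProductSpace ℂ H]
  [NormedAddCommGroup D] [InnerProductSpace ℂ D]

/-- A solution of `x t = x l + (t - l) • M (x t)` depends continuously on the parameter. -/
theorem continuousWithinAt_of_resolvent_eq (M : D →L[ℂ] D) {J : Set ℝ} {x : ℝ → D} {l : ℝ}
    (hx : ∀ t ∈ J, x t - x l = ((t - l : ℝ) : ℂ) • M (x t)) :
    ContinuousWithinAt x J l := by
  have hsmall : Filter.Tendsto (fun t : ℝ => |t - l| * ‖M‖) (nhdsWithin l J) (nhds 0) := by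
    have : Continuous fun t : ℝ => |t - l| * ‖M‖ := by fun_prop
    simpa using (this.tendsto l).mono_left nhdsWithin_le_nhds
  have hbound : ∀ᶠ t in nhdsWithin l J, ‖x t - x l‖ ≤ |t - l| * ‖M‖ * (2 * ‖x l‖) := by
    filter_upwards [hsmall.eventually (gt_mem_nhds (show (0 : ℝ) < 1 / 2 by norm_num)),
      self_mem_nhdsWithin] with t ht htJ
    have h1 : ‖x t - x l‖ ≤ |t - l| * ‖M‖ * ‖x t‖ := by
      rw [hx t htJ, norm_smul, Complex.norm_real, Real.norm_eq_abs, mul_assoc]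
      gcongr
      exact M.le_opNorm _
    have h2 : ‖x t‖ ≤ ‖x l‖ + ‖x t - x l‖ := by
      simpa using norm_add_le (x l) (x t - x l)
    have h3 : |t - l| * ‖M‖ * ‖x t‖ ≤ 1 / 2 * ‖x t‖ := by gcongr
    refine h1.trans ?_
    gcongr
    linarith
  rw [ContinuousWithinAt, tendsto_iff_norm_sub_tendsto_zero]
  exact squeeze_zero' (Filter.Eventually.of_forall fun _ => norm_nonneg _) hbound
    (by simpa using hsmall.mul_const (2 * ‖x l‖))

/-- The resolvent form `t ↦ f (x t)`, where `(A - t I* I) (x t) = f` for a symmetric `A`,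
has derivative `‖I (x l)‖ ^ 2`. -/
theorem hasDerivWithinAt_resolvent_form (I : D →L[ℂ] H)
    (A : D →L[ℂ] (D →L⋆[ℂ] ℂ)) (hA : ∀ u v, A u v = conj (A v u))
    (Is : H →L[ℂ] (D →L⋆[ℂ] ℂ)) (hIs : ∀ h v, Is h v = ⟪I v, h⟫_ℂ)
    {J : Set ℝ} {G : ℝ → ((D →L⋆[ℂ] ℂ) →L[ℂ] D)}
    (hG : ∀ l ∈ J,
      (G l).comp (A - (l : ℂ) • Is.comp I) = ContinuousLinearMap.id ℂ D ∧
      (A - (l : ℂ) • Is.comp I).comp (G l) = ContinuousLinearMap.id ℂ (D →L⋆[ℂ] ℂ))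
    (f : D →L⋆[ℂ] ℂ) {l : ℝ} (hl : l ∈ J) :
    HasDerivWithinAt (fun t => (f (G t f)).re) (‖I (G l f)‖ ^ 2) J l := by
  have hsol : ∀ t ∈ J, A (G t f) = f + (t : ℂ) • Is (I (G t f)) := fun t ht => by
    have h := congrArg (fun B => B f) (hG t ht).2
    simpa [sub_eq_iff_eq_add] using h
  have hinv : ∀ u, G l (A u - (l : ℂ) • Is (I u)) = u := fun u => by
    simpa using congrArg (fun B => B u) (hG l hl).1
  have hres : ∀ t ∈ J, G t f - G l f
      = ((t - l : ℝ) : ℂ) • ((G l).comp (Is.comp I)) (G t f) := fun t ht => by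
    have h := hinv (G t f)
    rw [hsol t ht, add_sub_assoc, map_add, map_sub, map_smul, map_smul] at h
    rw [sub_eq_iff_eq_add', Complex.ofReal_sub, sub_smul]
    exact h.symm
  have hcont : ContinuousWithinAt (fun t => G t f) J l :=
    continuousWithinAt_of_resolvent_eq ((G l).comp (Is.comp I)) hres
  have hdiff : ∀ t ∈ J, (f (G t f)).re - (f (G l f)).re
      = (t - l) * (⟪I (G l f), I (G t f)⟫_ℂ).re := fun t ht => by
    have hfl : f = A (G l f) - (l : ℂ) • Is (I (G l f)) := by rw [hsol l hl]; abel
    have h1 : f (G t f) = A (G l f) (G t f) - l * ⟪I (G t f), I (G l f)⟫_ℂ := by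
      simpa [hIs] using congrArg (fun B => B (G t f)) hfl
    have h2 : A (G t f) (G l f) = f (G l f) + t * ⟪I (G l f), I (G t f)⟫_ℂ := by
      rw [hsol t ht]; simp [hIs]
    rw [h1, hA, h2, ← inner_conj_symm (I (G t f))]
    simp [-inner_conj_symm]
    ring
  rw [hasDerivWithinAt_iff_tendsto_slope]
  have hlim : ContinuousWithinAt (fun t => (⟪I (G l f), I (G t f)⟫_ℂ).re) J l :=
    Complex.continuous_re.continuousAt.comp_continuousWithinAt
      (continuousWithinAt_const.inner (I.continuous.continuousAt.comp_continuousWithinAt hcont))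
  have hlim' := hlim.tendsto.mono_left (nhdsWithin_mono l (Set.sdiff_subset (t := {l})))
  rw [show (⟪I (G l f), I (G l f)⟫_ℂ).re = ‖I (G l f)‖ ^ 2 from
    inner_self_eq_norm_sq (𝕜 := ℂ) _] at hlim'
  refine hlim'.congr' ?_
  filter_upwards [self_mem_nhdsWithin] with t ht
  rw [slope_def_field, hdiff t ht.1, mul_div_cancel_left₀ _ (sub_ne_zero.2 ht.2)]

end Resolvent

/-- In the setting of a symmetric block operator
`T = (T11 T12; T21 T22)` with `Tᵢⱼ` bounded operators between the Hilbert spaces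
`D₁, D₂` and their anti-duals, embeddings `I₁ : D₁ → H₁`, `I₂ : D₂ → H₂`
(injective, with dense ranges), and adjoint embeddings `I₁*, I₂*`
(`(Iᵢ* x)(y) = ⟨x, Iᵢ y⟩`), let `J ⊆ ℝ` be an interval on which each
`T₂₂ - λ·I₂*I₂` is boundedly invertible with inverse `G λ`, and let
`S λ = T₁₁ - λ·I₁*I₁ - T₁₂ (G λ) T₂₁`.  Then for every fixed `y ∈ D₁` the
real-valued function `λ ↦ (S(λ) y)(y)` is differentiable on `J` with derivative
`-‖I₁ y‖² - ‖I₂ (G λ) T₂₁ y‖²`; consequently, for any `λ₁ < λ₂` in `J` one has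
`(S(λ₂)y)(y) - (S(λ₁)y)(y) ≤ -(λ₂ - λ₁)·‖I₁ y‖²`. -/
theorem statement8
    {H1 H2 D1 D2 : Type*}
    [NormedAddCommGroup H1] [InnerProductSpace ℂ H1] [CompleteSpace H1]
    [NormedAddCommGroup H2] [InnerProductSpace ℂ H2] [CompleteSpace H2]
    [NormedAddCommGroup D1] [InnerProductSpace ℂ D1] [CompleteSpace D1]
    [NormedAddCommGroup D2] [InnerProductSpace ℂ D2] [CompleteSpace D2]
    (I1 : D1 →L[ℂ] H1) (I2 : D2 →L[ℂ] H2)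
    (hI1inj : Function.Injective I1) (hI2inj : Function.Injective I2)
    (hI1dense : DenseRange I1) (hI2dense : DenseRange I2)
    (T11 : D1 →L[ℂ] (D1 →L⋆[ℂ] ℂ)) (T12 : D2 →L[ℂ] (D1 →L⋆[ℂ] ℂ))
    (T21 : D1 →L[ℂ] (D2 →L⋆[ℂ] ℂ)) (T22 : D2 →L[ℂ] (D2 →L⋆[ℂ] ℂ))
    -- symmetry of the block operator
    (hsymm : ∀ u v : D1 × D2,
      T11 u.1 v.1 + T12 u.2 v.1 + T21 u.1 v.2 + T22 u.2 v.2 =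
        conj (T11 v.1 u.1 + T12 v.2 u.1 + T21 v.1 u.2 + T22 v.2 u.2))
    -- the adjoint embeddings I₁*, I₂*
    (I1s : H1 →L[ℂ] (D1 →L⋆[ℂ] ℂ)) (I2s : H2 →L[ℂ] (D2 →L⋆[ℂ] ℂ))
    (hI1s : ∀ (x : H1) (y : D1), I1s x y = @inner ℂ _ _ (I1 y) x)
    (hI2s : ∀ (x : H2) (y : D2), I2s x y = @inner ℂ _ _ (I2 y) x)
    -- the interval J
    (J : Set ℝ) (hJ : J.OrdConnected)
    -- inverses of T₂₂ - λ·I₂*I₂ on J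
    (G : ℝ → ((D2 →L⋆[ℂ] ℂ) →L[ℂ] D2))
    (hG : ∀ l ∈ J,
      (G l).comp (T22 - (l : ℂ) • I2s.comp I2) = ContinuousLinearMap.id ℂ D2 ∧
      (T22 - (l : ℂ) • I2s.comp I2).comp (G l) =
        ContinuousLinearMap.id ℂ (D2 →L⋆[ℂ] ℂ))
    -- the transfer function S
    (S : ℝ → (D1 →L[ℂ] (D1 →L⋆[ℂ] ℂ)))
    (hS : ∀ l ∈ J,
      S l = T11 - (l : ℂ) • I1s.comp I1 - T12.comp ((G l).comp T21)) :
    ∀ y : D1,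
      (∀ l ∈ J, HasDerivWithinAt (fun t : ℝ => (((S t) y) y).re)
        (-‖I1 y‖ ^ 2 - ‖I2 ((G l) (T21 y))‖ ^ 2) J l) ∧
      (∀ l1 ∈ J, ∀ l2 ∈ J, l1 < l2 →
        (((S l2) y) y).re - (((S l1) y) y).re ≤ -(l2 - l1) * ‖I1 y‖ ^ 2) := by
  intro y
  have h22 : ∀ u v, T22 u v = conj (T22 v u) := fun u v => by
    simpa using hsymm (0, u) (0, v)
  have h12 : ∀ u, T12 u y = conj (T21 y u) := fun u => by
    simpa using hsymm (0, u) (y, 0)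
  have hform : ∀ t ∈ J, ((S t y) y).re
      = (T11 y y).re - t * ‖I1 y‖ ^ 2 - (T21 y (G t (T21 y))).re := fun t ht => by
    have hn : (⟪I1 y, I1 y⟫_ℂ).re = ‖I1 y‖ ^ 2 := inner_self_eq_norm_sq (𝕜 := ℂ) _
    simp [hS t ht, hI1s, h12, ← hn, -inner_self_eq_norm_sq_to_K]
  have hderiv : ∀ l ∈ J, HasDerivWithinAt (fun t : ℝ => ((S t y) y).re)
      (-‖I1 y‖ ^ 2 - ‖I2 (G l (T21 y))‖ ^ 2) J l := fun l hl => by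
    have h := (((hasDerivWithinAt_id l J).mul_const (‖I1 y‖ ^ 2)).const_sub (T11 y y).re).sub
      (hasDerivWithinAt_resolvent_form I2 T22 h22 I2s hI2s hG (T21 y) hl)
    rw [one_mul] at h
    exact h.congr hform (hform l hl)
  refine ⟨hderiv, fun l1 h1 l2 h2 hlt => ?_⟩
  have hshift : ∀ l ∈ J, HasDerivWithinAt (fun t : ℝ => ((S t y) y).re + t * ‖I1 y‖ ^ 2)
      (-‖I2 (G l (T21 y))‖ ^ 2) J l := fun l hl => by
    refine ((hderiv l hl).add ((hasDerivWithinAt_id l J).mul_const (‖I1 y‖ ^ 2))).congr_deriv ?_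
    ring
  have hanti := antitoneOn_of_hasDerivWithinAt_nonpos hJ.convex
    (fun l hl => (hshift l hl).continuousWithinAt)
    (fun l hl => (hshift l (interior_subset hl)).mono interior_subset)
    (fun l _ => neg_nonpos.2 (sq_nonneg _))
  have := hanti h1 h2 hlt.le
  simp only at this
  linarith
end
end

section
/- Let E₁, E₂ be finite-dimensional complex inner product spaces, μ ∈ ℝ, and let F be a continuously differentiable function from a neighborhood of μ in ℝ to the self-adjoint operators on E₁ ⊕ E₂, with block components F₁₁(λ) : E₁ → E₁, F₁₂(λ) : E₂ → E₁, F₂₁(λ) : E₁ → E₂, F₂₂(λ) : E₂ → E₂. Assume F₁₁(μ) = 0, F₂₁(μ) = 0, and that the self-adjoint operator F₁₁'(μ) (the derivative of F₁₁ at μ) and the operator F₂₂(μ) are invertible. Then for all λ > μ sufficiently close to μ, the number of negative eigenvalues of F(λ), counted with multiplicity, equals the number of negative eigenvalues of F₁₁'(μ) plus the number of negative eigenvalues of F(μ), each counted with multiplicity. -/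
noncomputable section

/-- The identification of a pair with an element of the Hilbert sum. -/
def emb {E1 E2 : Type*} (x : E1 × E2) : WithLp 2 (E1 × E2) :=
  (WithLp.equiv 2 (E1 × E2)).symm x

/-- The maximal dimension of a subspace on which the quadratic form
`y ↦ ⟨A y, y⟩` is negative definite; for a self-adjoint operator on a
finite-dimensional complex inner product space this equals the number of
negative eigenvalues counted with multiplicity. -/
def negEigCount {V : Type*} [NormedAddCommGroup V] [InnerProductSpace ℂ V]
    (A : V → V) : ℕ :=
  sSup {n : ℕ | ∃ M : Submodule ℂ V, Module.finrank ℂ M = n ∧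
    ∀ y ∈ M, y ≠ 0 → (@inner ℂ _ _ y (A y)).re < 0}

section QuadraticForms

variable {V : Type*} [NormedAddCommGroup V] [InnerProductSpace ℂ V]

lemma inner_symm_of_hasDerivAt {F : ℝ → V →L[ℂ] V} {D : V →L[ℂ] V} {μ : ℝ}
    (hF : HasDerivAt F D μ)
    (hsymm : ∀ᶠ l in nhds μ, ∀ x y, inner ℂ (F l x) y = inner ℂ x (F l y)) (x y : V) :
    inner ℂ (D x) y = inner ℂ x (D y) := by
  have happ : ∀ v, HasDerivAt (fun l => F l v) (D v) μ := fun v =>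
    (((ContinuousLinearMap.apply ℂ V v).restrictScalars ℝ).hasFDerivAt.comp_hasDerivAt μ hF)
  have h1 := (happ x).inner ℂ (hasDerivAt_const μ y)
  have h2 := (hasDerivAt_const μ x).inner ℂ (happ y)
  have := h1.unique (h2.congr_of_eventuallyEq (hsymm.mono fun l hl => hl x y))
  simpa using this

variable [FiniteDimensional ℂ V]

lemma negEigCount_eq_finrank (A : V → V) (N P : Submodule ℂ V)
    (hdim : Module.finrank ℂ V ≤ Module.finrank ℂ N + Module.finrank ℂ P)
    (hN : ∀ y ∈ N, y ≠ 0 → (inner ℂ y (A y)).re < 0)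
    (hP : ∀ y ∈ P, y ≠ 0 → 0 ≤ (inner ℂ y (A y)).re) :
    negEigCount A = Module.finrank ℂ N := by
  refine IsGreatest.csSup_eq ⟨⟨N, rfl, hN⟩, ?_⟩
  rintro n ⟨M, rfl, hM⟩
  have hdisj : M ⊓ P = ⊥ := by
    refine (Submodule.eq_bot_iff _).2 fun x hx => ?_
    by_contra hx0
    exact absurd (hM x hx.1 hx0) (not_lt.2 (hP x hx.2 hx0))
  have h := Submodule.finrank_sup_add_finrank_inf_eq M P
  rw [hdisj, finrank_bot] at h
  have := Submodule.finrank_le (M ⊔ P)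
  omega

lemma exists_re_inner_le_neg_mul_norm_sq (A : V →L[ℂ] V) (W : Submodule ℂ V)
    (hW : ∀ x ∈ W, x ≠ 0 → (inner ℂ x (A x)).re < 0) :
    ∃ c > 0, ∀ x ∈ W, (inner ℂ x (A x)).re ≤ -c * ‖x‖ ^ 2 := by
  have : ProperSpace V := FiniteDimensional.proper ℂ V
  have hcomp : IsCompact (Metric.sphere (0 : V) 1 ∩ W) :=
    (isCompact_sphere _ _).inter_right W.closed_of_finiteDimensional
  have hcont : Continuous fun x : V => (inner ℂ x (A x)).re := by fun_prop
  have hbound : ∃ c > 0, ∀ x ∈ Metric.sphere (0 : V) 1 ∩ W, (inner ℂ x (A x)).re ≤ -c := by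
    rcases (Metric.sphere (0 : V) 1 ∩ W).eq_empty_or_nonempty with he | hne
    · exact ⟨1, one_pos, by simp [he]⟩
    · obtain ⟨x₀, hx₀, hmax⟩ := hcomp.exists_isMaxOn hne hcont.continuousOn
      refine ⟨-(inner ℂ x₀ (A x₀)).re, ?_, fun x hx => by simpa using hmax hx⟩
      exact neg_pos.2 (hW x₀ hx₀.2 (ne_zero_of_mem_unit_sphere ⟨x₀, hx₀.1⟩))
  obtain ⟨c, hc, hcle⟩ := hbound
  refine ⟨c, hc, fun x hx => ?_⟩
  rcases eq_or_ne x 0 with rfl | hx0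
  · simp
  have hn : 0 < ‖x‖ := norm_pos_iff.2 hx0
  set u : V := ((‖x‖⁻¹ : ℝ) : ℂ) • x with hu
  have hux : x = ((‖x‖ : ℝ) : ℂ) • u := by
    rw [hu, smul_smul, ← Complex.ofReal_mul, mul_inv_cancel₀ hn.ne', Complex.ofReal_one, one_smul]
  have hu1 : ‖u‖ = 1 := by
    rw [hu, norm_smul, Complex.norm_real, norm_inv, norm_norm, inv_mul_cancel₀ hn.ne']
  have hmul : (inner ℂ x (A x)).re = ‖x‖ ^ 2 * (inner ℂ u (A u)).re := by
    conv_lhs => rw [hux]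
    rw [map_smul, inner_smul_left, inner_smul_right, Complex.conj_ofReal,
      Complex.re_ofReal_mul, Complex.re_ofReal_mul]
    ring
  rw [hmul]
  have := hcle u ⟨by simpa using hu1, W.smul_mem _ hx⟩
  nlinarith [sq_nonneg ‖x‖]

lemma exists_neg_pos_submodule (T : V →ₗ[ℂ] V) (hT : T.IsSymmetric) (hinj : Function.Injective T) :
    ∃ N P : Submodule ℂ V, Module.finrank ℂ N + Module.finrank ℂ P = Module.finrank ℂ V ∧
      (∀ y ∈ N, y ≠ 0 → (inner ℂ y (T y)).re < 0) ∧
      (∀ y ∈ P, y ≠ 0 → 0 < (inner ℂ y (T y)).re) := by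
  set b := hT.eigenvectorBasis rfl
  set ev := hT.eigenvalues rfl
  have hTb : ∀ i, T (b i) = (ev i : ℂ) • b i := hT.apply_eigenvectorBasis rfl
  have hne : ∀ i, ev i ≠ 0 := fun i hi => by
    have h : T (b i) = T 0 := by rw [hTb, hi, map_zero]; simp
    exact b.orthonormal.ne_zero i (hinj h)
  have hform : ∀ y : V, (inner ℂ y (T y)).re = ∑ i, ev i * ‖inner ℂ (b i) y‖ ^ 2 := fun y => by
    rw [← b.sum_inner_mul_inner y (T y), Complex.re_sum]
    refine Finset.sum_congr rfl fun i _ => ?_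
    rw [← hT (b i) y, hTb, inner_smul_left, Complex.conj_ofReal, ← inner_conj_symm y (b i),
      mul_left_comm, Complex.re_ofReal_mul, mul_comm (starRingEnd ℂ _), Complex.mul_conj,
      Complex.normSq_eq_norm_sq, Complex.ofReal_re]
  have hcoord : ∀ (s : Set (Fin (Module.finrank ℂ V))), ∀ y ∈ Submodule.span ℂ (b '' s),
      ∀ i ∉ s, inner ℂ (b i) y = 0 := fun s y hy i hi => by
    induction hy using Submodule.span_induction with
    | mem x hx =>
      obtain ⟨j, hj, rfl⟩ := hx
      exact b.orthonormal.2 (ne_of_mem_of_not_mem hj hi).symm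
    | zero => simp
    | add x y _ _ hx hy => rw [inner_add_right, hx, hy, add_zero]
    | smul a x _ hx => rw [inner_smul_right, hx, mul_zero]
  have hexists : ∀ y : V, y ≠ 0 → ∃ i, inner ℂ (b i) y ≠ 0 := fun y hy => by
    by_contra! h
    exact hy (by rw [← b.sum_repr' y]; simp [h])
  have hNneg : ∀ y ∈ Submodule.span ℂ (b '' {i | ev i < 0}), y ≠ 0 →
      (inner ℂ y (T y)).re < 0 := fun y hy hy0 => by
    rw [hform]
    obtain ⟨i, hi⟩ := hexists y hy0
    refine Finset.sum_neg' (fun j _ => ?_) ⟨i, Finset.mem_univ i, ?_⟩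
    · by_cases hj : ev j < 0
      · exact mul_nonpos_of_nonpos_of_nonneg hj.le (sq_nonneg _)
      · simp [hcoord _ y hy j hj]
    · have : ev i < 0 := by
        by_contra h
        exact hi (hcoord _ y hy i h)
      exact mul_neg_of_neg_of_pos this (by positivity)
  have hPpos : ∀ y ∈ Submodule.span ℂ (b '' {i | 0 < ev i}), y ≠ 0 →
      0 < (inner ℂ y (T y)).re := fun y hy hy0 => by
    rw [hform]
    obtain ⟨i, hi⟩ := hexists y hy0
    refine Finset.sum_pos' (fun j _ => ?_) ⟨i, Finset.mem_univ i, ?_⟩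
    · by_cases hj : 0 < ev j
      · positivity
      · simp [hcoord _ y hy j hj]
    · have : 0 < ev i := by
        by_contra h
        exact hi (hcoord _ y hy i h)
      positivity
  refine ⟨_, _, Submodule.finrank_add_eq_of_isCompl ⟨?_, ?_⟩, hNneg, hPpos⟩
  · refine Submodule.disjoint_def.2 fun x hx hx' => ?_
    by_contra hx0
    exact lt_asymm (hNneg x hx hx0) (hPpos x hx' hx0)
  · have hunion : {i | ev i < 0} ∪ {i | 0 < ev i} = Set.univ :=
      Set.eq_univ_of_forall fun i => lt_or_gt_of_ne (hne i)
    rw [codisjoint_iff, ← Submodule.span_union, ← Set.image_union, hunion, Set.image_univ,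
      ← b.coe_toBasis, b.toBasis.span_eq]

lemma eventually_re_inner_neg {F : ℝ → V →L[ℂ] V} {D : V →L[ℂ] V} {μ : ℝ}
    (hF : HasDerivAt F D μ) (hsymm : ∀ x y, inner ℂ (F μ x) y = inner ℂ x (F μ y))
    (W₁ W₂ : Submodule ℂ V) (h0 : ∀ x ∈ W₁, F μ x = 0)
    (h₁ : ∀ x ∈ W₁, x ≠ 0 → (inner ℂ x (D x)).re < 0)
    (h₂ : ∀ y ∈ W₂, y ≠ 0 → (inner ℂ y (F μ y)).re < 0) :
    ∀ᶠ l in nhdsWithin μ (Set.Ioi μ), ∀ x ∈ W₁, ∀ y ∈ W₂, x + y ≠ 0 →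
      (inner ℂ (x + y) (F l (x + y))).re < 0 := by
  obtain ⟨g, hg, hgle⟩ := exists_re_inner_le_neg_mul_norm_sq D W₁ h₁
  obtain ⟨b, hb, hble⟩ := exists_re_inner_le_neg_mul_norm_sq (F μ) W₂ h₂
  set K : ℝ := 4 * ‖D‖ ^ 2 / g + ‖D‖ + g / 4 with hK
  have hK0 : 0 < K := by positivity
  have hrem := (hasDerivAt_iff_isLittleO.1 hF).bound (show 0 < g / 8 by positivity)
  have hnear : ∀ᶠ l in nhds μ, l < μ + b / K := eventually_lt_nhds (by simp; positivity)
  filter_upwards [hrem.filter_mono nhdsWithin_le_nhds, hnear.filter_mono nhdsWithin_le_nhds,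
    self_mem_nhdsWithin] with l hl hlK hμl x hx y hy hxy
  set t := l - μ with ht
  have ht0 : 0 < t := sub_pos.2 hμl
  have htK : t * K < b := by
    rw [← lt_div_iff₀ hK0]
    linarith
  rw [Real.norm_of_nonneg ht0.le] at hl
  set R := F l - F μ - t • D with hR
  have hFl : F l (x + y) = F μ (x + y) + (t : ℂ) • D (x + y) + R (x + y) := by
    simp [hR]
  have hzero : inner ℂ (x + y) (F μ (x + y)) = inner ℂ y (F μ y) := by
    rw [map_add, h0 x hx, zero_add, inner_add_left, ← hsymm x, h0 x hx, inner_zero_left, zero_add]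
  have hRle : (inner ℂ (x + y) (R (x + y))).re ≤ g / 8 * t * (‖x‖ + ‖y‖) ^ 2 :=
    calc (inner ℂ (x + y) (R (x + y))).re ≤ ‖x + y‖ * ‖R (x + y)‖ := re_inner_le_norm (𝕜 := ℂ) _ _
      _ ≤ ‖x + y‖ * (g / 8 * t * ‖x + y‖) := by
          gcongr
          exact R.le_of_opNorm_le hl _
      _ = g / 8 * t * ‖x + y‖ ^ 2 := by ring
      _ ≤ _ := by gcongr; exact norm_add_le _ _
  have hDle : ∀ u v : V, (inner ℂ u (D v)).re ≤ ‖D‖ * (‖u‖ * ‖v‖) := fun u v =>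
    calc (inner ℂ u (D v)).re ≤ ‖u‖ * ‖D v‖ := re_inner_le_norm (𝕜 := ℂ) _ _
      _ ≤ ‖u‖ * (‖D‖ * ‖v‖) := by gcongr; exact D.le_opNorm v
      _ = _ := by ring
  have hDsum : (inner ℂ (x + y) (D (x + y))).re ≤
      -g * ‖x‖ ^ 2 + 2 * ‖D‖ * (‖x‖ * ‖y‖) + ‖D‖ * ‖y‖ ^ 2 := by
    rw [map_add, inner_add_left, inner_add_right, inner_add_right]
    simp only [Complex.add_re]
    linarith [hgle x hx, hDle x y, hDle y x, hDle y y]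
  have hcross : 2 * ‖D‖ * (‖x‖ * ‖y‖) ≤ g / 4 * ‖x‖ ^ 2 + 4 * ‖D‖ ^ 2 / g * ‖y‖ ^ 2 := by
    have h : g / 4 * ‖x‖ ^ 2 + 4 * ‖D‖ ^ 2 / g * ‖y‖ ^ 2 - 2 * ‖D‖ * (‖x‖ * ‖y‖) =
        (g * ‖x‖ / 2 - 2 * ‖D‖ * ‖y‖) ^ 2 / g := by
      field_simp
      ring
    have : 0 ≤ (g * ‖x‖ / 2 - 2 * ‖D‖ * ‖y‖) ^ 2 / g := by positivity
    linarith
  have hsq : (‖x‖ + ‖y‖) ^ 2 ≤ 2 * ‖x‖ ^ 2 + 2 * ‖y‖ ^ 2 := by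
    nlinarith [sq_nonneg (‖x‖ - ‖y‖)]
  have hfinal : (inner ℂ (x + y) (F l (x + y))).re ≤
      -(g / 2 * t) * ‖x‖ ^ 2 - (b - t * K) * ‖y‖ ^ 2 := by
    rw [hFl, inner_add_right, inner_add_right, inner_smul_right, hzero]
    simp only [Complex.add_re, Complex.re_ofReal_mul]
    have h1 := mul_le_mul_of_nonneg_left (hDsum.trans (by gcongr : _ ≤
      -g * ‖x‖ ^ 2 + (g / 4 * ‖x‖ ^ 2 + 4 * ‖D‖ ^ 2 / g * ‖y‖ ^ 2) + ‖D‖ * ‖y‖ ^ 2)) ht0.le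
    have h2 := mul_le_mul_of_nonneg_left hsq (show 0 ≤ g / 8 * t by positivity)
    have h3 := hble y hy
    rw [hK]
    linarith
  refine hfinal.trans_lt ?_
  have hcoef : 0 < b - t * K := by linarith
  by_cases hx0 : x = 0
  · have hy0 : 0 < ‖y‖ := norm_pos_iff.2 fun hy0 => hxy (by simp [hx0, hy0])
    have : 0 < (b - t * K) * ‖y‖ ^ 2 := by positivity
    simp only [hx0, norm_zero]
    linarith
  · have hx0 : 0 < ‖x‖ := norm_pos_iff.2 hx0
    have : 0 < g / 2 * t * ‖x‖ ^ 2 := by positivity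
    have : 0 ≤ (b - t * K) * ‖y‖ ^ 2 := by positivity
    linarith

end QuadraticForms

section Blocks

lemma emb_add_emb {E1 E2 : Type*} [NormedAddCommGroup E1] [NormedAddCommGroup E2]
    (z : WithLp 2 (E1 × E2)) : emb (z.fst, 0) + emb (0, z.snd) = z := by
  refine WithLp.ofLp_injective 2 (Prod.ext ?_ ?_) <;> simp [emb]

variable {E1 E2 : Type*}
    [NormedAddCommGroup E1] [InnerProductSpace ℂ E1]
    [NormedAddCommGroup E2] [InnerProductSpace ℂ E2]

/-- The subspace `M₁ ⊕ M₂` of the Hilbert sum. -/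
def blockSubmodule (M₁ : Submodule ℂ E1) (M₂ : Submodule ℂ E2) :
    Submodule ℂ (WithLp 2 (E1 × E2)) :=
  (M₁.prod M₂).map (WithLp.linearEquiv 2 ℂ (E1 × E2)).symm.toLinearMap

lemma mem_blockSubmodule {M₁ : Submodule ℂ E1} {M₂ : Submodule ℂ E2}
    {z : WithLp 2 (E1 × E2)} :
    z ∈ blockSubmodule M₁ M₂ ↔ z.fst ∈ M₁ ∧ z.snd ∈ M₂ := by
  simp [blockSubmodule, Submodule.mem_map_equiv, Submodule.mem_prod]

lemma inner_emb_left (x : E1) (z : WithLp 2 (E1 × E2)) :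
    inner ℂ (emb (x, 0)) z = inner ℂ x z.fst := by
  simp [emb, WithLp.prod_inner_apply]

lemma inner_emb_right (y : E2) (z : WithLp 2 (E1 × E2)) :
    inner ℂ (emb (0, y)) z = inner ℂ y z.snd := by
  simp [emb, WithLp.prod_inner_apply]

/-- The inclusion of the first summand in the Hilbert sum. -/
def embFst : E1 →ₗ[ℂ] WithLp 2 (E1 × E2) :=
  (WithLp.linearEquiv 2 ℂ (E1 × E2)).symm.toLinearMap ∘ₗ LinearMap.inl ℂ E1 E2

/-- The inclusion of the second summand in the Hilbert sum. -/
def embSnd : E2 →ₗ[ℂ] WithLp 2 (E1 × E2) :=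
  (WithLp.linearEquiv 2 ℂ (E1 × E2)).symm.toLinearMap ∘ₗ LinearMap.inr ℂ E1 E2

lemma embFst_apply (x : E1) : (embFst x : WithLp 2 (E1 × E2)) = emb (x, 0) := rfl

lemma embSnd_apply (y : E2) : (embSnd y : WithLp 2 (E1 × E2)) = emb (0, y) := rfl

/-- The diagonal block of an operator on the Hilbert sum acting on the first summand. -/
def blockFst (A : WithLp 2 (E1 × E2) →L[ℂ] WithLp 2 (E1 × E2)) : E1 →ₗ[ℂ] E1 :=
  LinearMap.fst ℂ E1 E2 ∘ₗ (WithLp.linearEquiv 2 ℂ (E1 × E2)).toLinearMap ∘ₗ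
    A.toLinearMap ∘ₗ embFst

/-- The diagonal block of an operator on the Hilbert sum acting on the second summand. -/
def blockSnd (A : WithLp 2 (E1 × E2) →L[ℂ] WithLp 2 (E1 × E2)) : E2 →ₗ[ℂ] E2 :=
  LinearMap.snd ℂ E1 E2 ∘ₗ (WithLp.linearEquiv 2 ℂ (E1 × E2)).toLinearMap ∘ₗ
    A.toLinearMap ∘ₗ embSnd

lemma inner_emb_apply_fst (A : WithLp 2 (E1 × E2) →L[ℂ] WithLp 2 (E1 × E2)) (x x' : E1) :
    inner ℂ (emb (x, 0)) (A (emb (x', 0))) = inner ℂ x (blockFst A x') :=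
  inner_emb_left _ _

lemma inner_emb_apply_snd (A : WithLp 2 (E1 × E2) →L[ℂ] WithLp 2 (E1 × E2)) (y y' : E2) :
    inner ℂ (emb (0, y)) (A (emb (0, y'))) = inner ℂ y (blockSnd A y') :=
  inner_emb_right _ _

lemma blockFst_isSymmetric {A : WithLp 2 (E1 × E2) →L[ℂ] WithLp 2 (E1 × E2)}
    (hA : ∀ x y, inner ℂ (A x) y = inner ℂ x (A y)) : (blockFst A).IsSymmetric := fun x y => by
  rw [← inner_emb_apply_fst, ← hA, ← inner_conj_symm, ← inner_emb_apply_fst, inner_conj_symm]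

lemma blockSnd_isSymmetric {A : WithLp 2 (E1 × E2) →L[ℂ] WithLp 2 (E1 × E2)}
    (hA : ∀ x y, inner ℂ (A x) y = inner ℂ x (A y)) : (blockSnd A).IsSymmetric := fun x y => by
  rw [← inner_emb_apply_snd, ← hA, ← inner_conj_symm, ← inner_emb_apply_snd, inner_conj_symm]

lemma inner_apply_self_eq_blockSnd {A : WithLp 2 (E1 × E2) →L[ℂ] WithLp 2 (E1 × E2)}
    (hA : ∀ x y, inner ℂ (A x) y = inner ℂ x (A y)) (h0 : ∀ x : E1, A (emb (x, 0)) = 0)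
    (z : WithLp 2 (E1 × E2)) : inner ℂ z (A z) = inner ℂ z.snd (blockSnd A z.snd) := by
  rw [← inner_emb_apply_snd]
  conv_lhs => rw [← emb_add_emb z]
  rw [map_add, h0, zero_add, inner_add_left, ← hA, h0, inner_zero_left, zero_add]

lemma eventually_re_inner_neg_block [FiniteDimensional ℂ E1] [FiniteDimensional ℂ E2]
    {F : ℝ → WithLp 2 (E1 × E2) →L[ℂ] WithLp 2 (E1 × E2)}
    {D : WithLp 2 (E1 × E2) →L[ℂ] WithLp 2 (E1 × E2)} {μ : ℝ}
    (hF : HasDerivAt F D μ) (hsymm : ∀ x y, inner ℂ (F μ x) y = inner ℂ x (F μ y))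
    (h0 : ∀ x : E1, F μ (emb (x, 0)) = 0)
    (M₁ : Submodule ℂ E1) (M₂ : Submodule ℂ E2)
    (h₁ : ∀ x ∈ M₁, x ≠ 0 → (inner ℂ x (blockFst D x)).re < 0)
    (h₂ : ∀ y ∈ M₂, y ≠ 0 → (inner ℂ y (blockSnd (F μ) y)).re < 0) :
    ∀ᶠ l in nhdsWithin μ (Set.Ioi μ), ∀ z ∈ blockSubmodule M₁ M₂, z ≠ 0 →
      (inner ℂ z (F l z)).re < 0 := by
  refine (eventually_re_inner_neg hF hsymm (M₁.map embFst) (M₂.map embSnd) ?_ ?_ ?_).mono ?_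
  · rintro _ ⟨x, -, rfl⟩
    exact h0 x
  · rintro _ ⟨x, hx, rfl⟩ hne
    rw [embFst_apply, inner_emb_apply_fst]
    exact h₁ x hx fun h => hne (by rw [h, map_zero])
  · rintro _ ⟨y, hy, rfl⟩ hne
    rw [embSnd_apply, inner_emb_apply_snd]
    exact h₂ y hy fun h => hne (by rw [h, map_zero])
  · intro l hl z hz hne
    rw [mem_blockSubmodule] at hz
    have := hl _ (Submodule.mem_map_of_mem hz.1) _ (Submodule.mem_map_of_mem hz.2)
    rw [embFst_apply, embSnd_apply, emb_add_emb] at this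
    exact this hne

variable [FiniteDimensional ℂ E1] [FiniteDimensional ℂ E2]

lemma finrank_blockSubmodule (M₁ : Submodule ℂ E1) (M₂ : Submodule ℂ E2) :
    Module.finrank ℂ (blockSubmodule M₁ M₂) = Module.finrank ℂ M₁ + Module.finrank ℂ M₂ := by
  have hprod : M₁.prod M₂ = LinearMap.range (M₁.subtype.prodMap M₂.subtype) := by
    rw [LinearMap.range_prodMap, Submodule.range_subtype, Submodule.range_subtype]
  rw [blockSubmodule, LinearEquiv.finrank_map_eq, hprod, LinearMap.finrank_range_of_inj,
    Module.finrank_prod]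
  exact M₁.injective_subtype.prodMap M₂.injective_subtype

lemma finrank_hilbertSum :
    Module.finrank ℂ (WithLp 2 (E1 × E2)) = Module.finrank ℂ E1 + Module.finrank ℂ E2 := by
  rw [(WithLp.linearEquiv 2 ℂ (E1 × E2)).finrank_eq, Module.finrank_prod]

end Blocks

/-- Let `E₁, E₂` be finite-dimensional complex inner product
spaces, `μ ∈ ℝ`, and let `F` be a continuously differentiable function (with
derivative `F'`) from a neighborhood of `μ` in `ℝ` to the self-adjoint operators
on `E₁ ⊕ E₂` (the `ℓ²`-sum), with block components `Fᵢⱼ(λ)`.  Assume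
`F₁₁(μ) = 0`, `F₂₁(μ) = 0` (together: `F(μ)` vanishes on `E₁ ⊕ 0`), and that
the operators `F₁₁'(μ) : E₁ → E₁` and `F₂₂(μ) : E₂ → E₂` are invertible.  Then
for all `λ > μ` sufficiently close to `μ`, the number of negative eigenvalues of
`F(λ)`, counted with multiplicity, equals the number of negative eigenvalues of
`F₁₁'(μ)` plus the number of negative eigenvalues of `F(μ)`. -/
theorem statement18
    {E1 E2 : Type*}
    [NormedAddCommGroup E1] [InnerProductSpace ℂ E1] [FiniteDimensional ℂ E1]
    [NormedAddCommGroup E2] [InnerProductSpace ℂ E2] [FiniteDimensional ℂ E2]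
    (μ : ℝ)
    (F F' : ℝ → (WithLp 2 (E1 × E2) →L[ℂ] WithLp 2 (E1 × E2)))
    (δ : ℝ) (hδ : 0 < δ)
    (hderiv : ∀ l ∈ Metric.ball μ δ, HasDerivAt F (F' l) l)
    (hcont : ContinuousOn F' (Metric.ball μ δ))
    (hsa : ∀ l ∈ Metric.ball μ δ, ∀ x y : WithLp 2 (E1 × E2),
      @inner ℂ _ _ (F l x) y = @inner ℂ _ _ x (F l y))
    (h0 : ∀ x : E1, F μ (emb (x, 0)) = 0)
    (h11' : Function.Bijective
      (fun x : E1 => ((WithLp.equiv 2 (E1 × E2)) (F' μ (emb (x, 0)))).1))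
    (h22 : Function.Bijective
      (fun y : E2 => ((WithLp.equiv 2 (E1 × E2)) (F μ (emb (0, y)))).2)) :
    ∃ δ' > 0, ∀ l : ℝ, μ < l → l < μ + δ' →
      negEigCount (F l) =
        negEigCount (fun x : E1 => ((WithLp.equiv 2 (E1 × E2)) (F' μ (emb (x, 0)))).1)
          + negEigCount (F μ) := by
  have hsymm := hsa μ (Metric.mem_ball_self hδ)
  have hD := hderiv μ (Metric.mem_ball_self hδ)
  have hDsymm := inner_symm_of_hasDerivAt hD
    (Filter.eventually_of_mem (Metric.ball_mem_nhds μ hδ) hsa)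
  obtain ⟨N₁, P₁, hdim₁, hN₁, hP₁⟩ := exists_neg_pos_submodule (blockFst (F' μ))
    (blockFst_isSymmetric hDsymm) h11'.injective
  obtain ⟨N₂, P₂, hdim₂, hN₂, hP₂⟩ := exists_neg_pos_submodule (blockSnd (F μ))
    (blockSnd_isSymmetric hsymm) h22.injective
  have hcount₁ : negEigCount (blockFst (F' μ)) = Module.finrank ℂ N₁ :=
    negEigCount_eq_finrank _ N₁ P₁ hdim₁.ge hN₁ fun y hy hy0 => (hP₁ y hy hy0).le
  have hcount₂ : negEigCount (F μ) = Module.finrank ℂ N₂ := by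
    rw [negEigCount_eq_finrank (F μ) (blockSubmodule ⊥ N₂) (blockSubmodule ⊤ P₂),
      finrank_blockSubmodule, finrank_bot, zero_add]
    · rw [finrank_blockSubmodule, finrank_blockSubmodule, finrank_hilbertSum, finrank_bot,
        finrank_top]
      omega
    · intro z hz hz0
      rw [mem_blockSubmodule, Submodule.mem_bot] at hz
      rw [inner_apply_self_eq_blockSnd hsymm h0]
      refine hN₂ _ hz.2 fun h => hz0 ?_
      rw [← emb_add_emb z, hz.1, h]
      exact add_zero 0
    · intro z hz _
      rw [mem_blockSubmodule] at hz
      rw [inner_apply_self_eq_blockSnd hsymm h0]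
      rcases eq_or_ne z.snd 0 with h | h
      · simp [h]
      · exact (hP₂ _ hz.2 h).le
  have hneg := eventually_re_inner_neg_block hD hsymm h0 N₁ N₂ hN₁ hN₂
  have hpos := eventually_re_inner_neg_block (F := -F) hD.neg (fun x y => by
      simp only [Pi.neg_apply, neg_apply, inner_neg_left, inner_neg_right, hsymm])
    (by simpa using h0) P₁ P₂
    (fun x hx hx0 => by
      rw [← inner_emb_apply_fst]
      simp only [neg_apply, inner_neg_right, Complex.neg_re, inner_emb_apply_fst]
      exact neg_neg_of_pos (hP₁ x hx hx0))
    (fun y hy hy0 => by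
      rw [← inner_emb_apply_snd]
      simp only [Pi.neg_apply, neg_apply, inner_neg_right, Complex.neg_re, inner_emb_apply_snd]
      exact neg_neg_of_pos (hP₂ y hy hy0))
  obtain ⟨u, hu, hsub⟩ := mem_nhdsGT_iff_exists_Ioo_subset.1 (hneg.and hpos)
  refine ⟨u - μ, sub_pos.2 hu, fun l hl hlu => ?_⟩
  obtain ⟨hln, hlp⟩ := hsub ⟨hl, by linarith⟩
  change negEigCount (F l) = negEigCount (blockFst (F' μ)) + negEigCount (F μ)
  rw [hcount₁, hcount₂, negEigCount_eq_finrank (F l) (blockSubmodule N₁ N₂) (blockSubmodule P₁ P₂) _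
    hln, finrank_blockSubmodule]
  · intro z hz hz0
    have := hlp z hz hz0
    simp only [Pi.neg_apply, neg_apply, inner_neg_right, Complex.neg_re] at this
    linarith
  · rw [finrank_blockSubmodule, finrank_blockSubmodule, finrank_hilbertSum]
    omega
end
end
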